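/- arXiv:1204.1600 — 5 statements merged into one kernel-verified Lean document; each statement's English description precedes it below -/
import Mathlib

section
/- Let E be a finite-dimensional real inner product space of dimension at least 2, and let R be an algebraic curvature tensor on E with associated Jacobi operators J_X. Then R satisfies the Rakić duality principle if and only if R is Osserman. That is, the following are equivalent: (a) for all unit vectors X, Y in E and every real number λ, J_X Y = λY implies J_Y X = λX; (b) the characteristic polynomial of J_X is the same for all unit vectors X in E. -/
open RealInnerProductSpace

section Aux

variable {E : Type*} [NormedAddCommGroup E] [InnerProductSpace ℝ E] [FiniteDimensional ℝ E]

/-- A product formula for the derivative of a determinant at a diagonal matrix. -/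
lemma aux_det_deriv {n : Type*} [Fintype n] [DecidableEq n] (M : ℝ → Matrix n n ℝ)
    (M' : Matrix n n ℝ) (hM : ∀ i j, HasDerivAt (fun t => M t i j) (M' i j) 0)
    (h0 : ∀ i j, i ≠ j → M 0 i j = 0) (hd : ∀ i, M' i i = 0) :
    HasDerivAt (fun t => (M t).det) 0 0 := by
  have h1 : ∀ σ : Equiv.Perm n, HasDerivAt
      (fun t => ((Equiv.Perm.sign σ : ℤ) : ℝ) * ∏ i, M t (σ i) i) 0 0 := by
    intro σ
    have h2 := (HasDerivAt.fun_finsetProd (u := Finset.univ)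
      (f := fun i t => M t (σ i) i) (fun i _ => hM (σ i) i)).const_mul
        ((Equiv.Perm.sign σ : ℤ) : ℝ)
    refine h2.congr_deriv ?_
    apply mul_eq_zero_of_right
    apply Finset.sum_eq_zero
    intro i _
    by_cases hi : σ i = i
    · rw [hi, hd]; simp
    · rw [smul_eq_mul]
      apply mul_eq_zero_of_left
      apply Finset.prod_eq_zero (i := σ i)
      · simp [hi]
      · apply h0
        intro h
        exact hi (σ.injective h)
  have h3 := HasDerivAt.fun_sum (u := (Finset.univ : Finset (Equiv.Perm n))) (fun σ _ => h1 σ)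
  simpa [Matrix.det_apply'] using h3

lemma aux_aeval (T : E →ₗ[ℝ] E) (y : E) (c : ℝ) (h : T y = c • y) (p : Polynomial ℝ) :
    Polynomial.aeval T p y = p.eval c • y := by
  induction p using Polynomial.induction_on' with
  | add p q hp hq => simp [hp, hq, add_smul]
  | monomial k a =>
    have : ∀ k : ℕ, (T ^ k) y = c ^ k • y := by
      intro k
      induction k with
      | zero => simp
      | succ k ih => rw [pow_succ, Module.End.mul_apply, h, map_smul, ih, smul_smul]; ring_nf
    simp [Polynomial.aeval_monomial, this, smul_smul, mul_comm]

lemma aux_annih (T : E →ₗ[ℝ] E) (hT : T.IsSymmetric) :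
    Polynomial.aeval T (∏ r ∈ T.charpoly.roots.toFinset, (Polynomial.X - Polynomial.C r)) = 0 := by
  have hb := hT.apply_eigenvectorBasis rfl
  apply (hT.eigenvectorBasis rfl).toBasis.ext
  intro i
  simp only [OrthonormalBasis.coe_toBasis, LinearMap.zero_apply]
  rw [aux_aeval T _ _ (hb i), Polynomial.eval_prod, Finset.prod_eq_zero, zero_smul]
  · rw [Multiset.mem_toFinset, Polynomial.mem_roots (LinearMap.charpoly_monic T).ne_zero]
    exact (Module.End.hasEigenvalue_iff_isRoot_charpoly _ _).1 (hT.hasEigenvalue_eigenvalues rfl i)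
  · simp

end Aux

theorem duality_iff_osserman
    {E : Type*} [NormedAddCommGroup E] [InnerProductSpace ℝ E] [FiniteDimensional ℝ E]
    (hdim : 2 ≤ Module.finrank ℝ E)
    (R : E → E → E → E → ℝ)
    (hlin1 : ∀ Y Z W, IsLinearMap ℝ (fun X => R X Y Z W))
    (hlin2 : ∀ X Z W, IsLinearMap ℝ (fun Y => R X Y Z W))
    (hlin3 : ∀ X Y W, IsLinearMap ℝ (fun Z => R X Y Z W))
    (hlin4 : ∀ X Y Z, IsLinearMap ℝ (fun W => R X Y Z W))
    (hanti : ∀ X Y Z W, R X Y Z W = - R Y X Z W)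
    (hpair : ∀ X Y Z W, R X Y Z W = R Z W X Y)
    (hbianchi : ∀ X Y Z W, R X Y Z W + R Y Z X W + R Z X Y W = 0)
    (J : E → E →ₗ[ℝ] E)
    (hJ : ∀ X Y Z : E, ⟪J X Y, Z⟫ = R Y X X Z) :
    (∀ X Y : E, ‖X‖ = 1 → ‖Y‖ = 1 → ∀ μ : ℝ, J X Y = μ • Y → J Y X = μ • X)
      ↔
    (∀ X Y : E, ‖X‖ = 1 → ‖Y‖ = 1 → (J X).charpoly = (J Y).charpoly) := by
  have hrev : ∀ X Y Z W, R X Y Z W = R Y X W Z := by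
    intro X Y Z W
    rw [hanti X Y, hpair Y X, hanti Z W, hpair W Z, neg_neg]
  have hsym : ∀ X, (J X).IsSymmetric := by
    intro X Y Z
    rw [hJ, real_inner_comm, hJ, hrev, hpair]
  obtain ⟨K, hK⟩ : ∃ K : E → E → E →ₗ[ℝ] E, ∀ X Z, K X Z = J (X + Z) - J X - J Z := ⟨_, fun _ _ => rfl⟩
  have hKi : ∀ X Z Y W, ⟪K X Z Y, W⟫ = R Y X Z W + R Y Z X W := by
    intro X Z Y W
    rw [hK]
    simp only [LinearMap.sub_apply, inner_sub_left, hJ]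
    have h1 := (hlin2 Y (X + Z) W).map_add X Z
    have h2 := (hlin3 Y X W).map_add X Z
    have h3 := (hlin3 Y Z W).map_add X Z
    beta_reduce at h1 h2 h3
    rw [h1, h2, h3]; ring
  have hKd : ∀ X Z Y, ⟪K X Z Y, Y⟫ = 2 * ⟪J Y X, Z⟫ := by
    intro X Z Y
    rw [hKi, hJ, hrev Y X Z Y, hpair Y Z X Y]; ring
  have hJq : ∀ (a b : ℝ) X Z Y, J (a • X + b • Z) Y =
      a ^ 2 • J X Y + (a * b) • K X Z Y + b ^ 2 • J Z Y := by
    intro a b X Z Y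
    apply ext_inner_right ℝ
    intro W
    simp only [inner_add_left, inner_smul_left, hJ, hKi]
    have h1 := fun U => (hlin2 Y U W).map_add (a • X) (b • Z)
    have h2 := fun U => (hlin3 Y U W).map_add (a • X) (b • Z)
    have h3 := fun U V (c : ℝ) => (hlin2 Y U W).map_smul c V
    have h4 := fun U V (c : ℝ) => (hlin3 Y U W).map_smul c V
    simp only [smul_eq_mul] at h1 h2 h3 h4
    simp only [h1, h2, h3, h4]
    simp
    ring
  constructor
  · intro hdual
    have key : ∀ (s : ℝ) X Z, ‖X‖ = 1 → ⟪X, Z⟫ = 0 → HasDerivAt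
        (fun t : ℝ => (J (Real.cos t • X + Real.sin t • Z)).charpoly.eval s) 0 0 := by
      intro s X Z hX hXZ
      let b := (hsym X).eigenvectorBasis rfl
      let μ := (hsym X).eigenvalues rfl
      have hb : ∀ i, J X (b i) = μ i • b i := (hsym X).apply_eigenvectorBasis rfl
      have hon : ∀ i j, ⟪b i, b j⟫ = if i = j then (1:ℝ) else 0 :=
        orthonormal_iff_ite.1 b.orthonormal
      let M : ℝ → Matrix _ _ ℝ := fun t => Matrix.scalar _ s -
        LinearMap.toMatrix b.toBasis b.toBasis (J (Real.cos t • X + Real.sin t • Z))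
      have hMe : ∀ t i j, M t i j = (Matrix.scalar _ s : Matrix _ _ ℝ) i j -
          (Real.cos t ^ 2 * ⟪b i, J X (b j)⟫ + Real.cos t * Real.sin t * ⟪b i, K X Z (b j)⟫
            + Real.sin t ^ 2 * ⟪b i, J Z (b j)⟫) := by
        intro t i j
        simp only [M, Matrix.sub_apply, LinearMap.toMatrix_apply, OrthonormalBasis.coe_toBasis,
          OrthonormalBasis.coe_toBasis_repr_apply, OrthonormalBasis.repr_apply_apply, hJq,
          inner_add_right, inner_smul_right]
      have hdet : ∀ t, (J (Real.cos t • X + Real.sin t • Z)).charpoly.eval s = (M t).det := by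
        intro t
        rw [← LinearMap.charpoly_toMatrix _ b.toBasis, Matrix.eval_charpoly]
      simp only [hdet]
      apply aux_det_deriv M (fun i j => - ⟪b i, K X Z (b j)⟫)
      · intro i j
        simp only [hMe]
        have hc := Real.hasDerivAt_cos 0
        have hs := Real.hasDerivAt_sin 0
        refine HasDerivAt.congr_deriv (((((hc.fun_pow 2).mul_const ⟪b i, J X (b j)⟫).fun_add
          ((hc.fun_mul hs).mul_const ⟪b i, K X Z (b j)⟫)).fun_add
          ((hs.fun_pow 2).mul_const ⟪b i, J Z (b j)⟫)).const_sub
            ((Matrix.scalar _ s : Matrix _ _ ℝ) i j)) ?_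
        simp
      · intro i j hij
        rw [hMe, hb, inner_smul_right, hon]
        simp [hij]
      · intro i
        have := hdual X (b i) hX (b.orthonormal.1 i) (μ i) (hb i)
        rw [real_inner_comm, hKd, this, inner_smul_left, hXZ]; simp
    intro X Y hX hY
    apply Polynomial.funext
    intro s
    have hXX : ⟪X, X⟫ = (1:ℝ) := by rw [real_inner_self_eq_norm_sq, hX]; norm_num
    have hYY : ⟪Y, Y⟫ = (1:ℝ) := by rw [real_inner_self_eq_norm_sq, hY]; norm_num
    obtain ⟨p, hp⟩ : ∃ p : ℝ, p = ⟪X, Y⟫ := ⟨_, rfl⟩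
    obtain ⟨w, hw⟩ : ∃ w : E, w = Y - p • X := ⟨_, rfl⟩
    have hYw : Y = p • X + w := by rw [hw]; abel
    have hXw : ⟪X, w⟫ = (0:ℝ) := by
      rw [hw, inner_sub_right, inner_smul_right, hXX, ← hp]; ring
    have hwX : ⟪w, X⟫ = (0:ℝ) := by rw [real_inner_comm, hXw]
    have hnw : p ^ 2 + ‖w‖ ^ 2 = 1 := by
      rw [← real_inner_self_eq_norm_sq, ← hYY, hYw]
      simp only [inner_add_left, inner_add_right, inner_smul_left, inner_smul_right, hXX, hXw, hwX]
      simp; ring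
    by_cases hw0 : w = 0
    · have : J X = J Y := by
        ext V
        have h := hJq p 0 X 0 V
        rw [hw0] at hnw hYw
        rw [norm_zero, zero_pow two_ne_zero, add_zero] at hnw
        rw [hnw] at h
        rw [hYw]
        simpa using h.symm
      rw [this]
    · have hwn : ‖w‖ ≠ 0 := norm_ne_zero_iff.2 hw0
      obtain ⟨Z, hZ⟩ : ∃ Z : E, Z = ‖w‖⁻¹ • w := ⟨_, rfl⟩
      have hwZ : w = ‖w‖ • Z := by rw [hZ, smul_smul, mul_inv_cancel₀ hwn, one_smul]
      have hXZ : ⟪X, Z⟫ = (0:ℝ) := by rw [hZ, inner_smul_right, hXw, mul_zero]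
      have hZX : ⟪Z, X⟫ = (0:ℝ) := by rw [real_inner_comm, hXZ]
      have hZZ : ⟪Z, Z⟫ = (1:ℝ) := by
        rw [hZ, inner_smul_right, inner_smul_left, real_inner_self_eq_norm_sq]
        simp; field_simp
      have hD : ∀ t₀ : ℝ, HasDerivAt
          (fun t : ℝ => (J (Real.cos t • X + Real.sin t • Z)).charpoly.eval s) 0 t₀ := by
        intro t₀
        have h := key s (Real.cos t₀ • X + Real.sin t₀ • Z) (-Real.sin t₀ • X + Real.cos t₀ • Z)
          (by
            have : ‖Real.cos t₀ • X + Real.sin t₀ • Z‖ ^ 2 = 1 := by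
              rw [← real_inner_self_eq_norm_sq]
              simp only [inner_add_left, inner_add_right, inner_smul_left, inner_smul_right,
                hXX, hXZ, hZX, hZZ]
              have := Real.sin_sq_add_cos_sq t₀
              simp; nlinarith
            exact (pow_eq_one_iff_of_nonneg (norm_nonneg _) two_ne_zero).1 this)
          (by
              simp only [inner_add_left, inner_add_right, inner_smul_left, inner_smul_right,
                hXX, hXZ, hZX, hZZ]
              simp; ring)
        have h' := HasDerivAt.comp_sub_const (x := t₀) (a := t₀) (by rw [sub_self]; exact h)
        refine h'.congr_of_eventuallyEq (Filter.Eventually.of_forall fun t => ?_)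
        beta_reduce
        congr 3
        have e : t = (t - t₀) + t₀ := by ring
        conv_lhs => rw [e, Real.cos_add, Real.sin_add]
        module
      have hconst := is_const_of_deriv_eq_zero (fun t => (hD t).differentiableAt)
        (fun t => (hD t).deriv) 0 (Real.arccos p)
      have hs : Real.sin (Real.arccos p) = ‖w‖ := by
        rw [Real.sin_arccos, ← hnw, add_sub_cancel_left, Real.sqrt_sq (norm_nonneg _)]
      have hc : Real.cos (Real.arccos p) = p := by
        apply Real.cos_arccos <;> nlinarith [sq_nonneg ‖w‖]
      simp only [hs, hc, ← hwZ, ← hYw] at hconst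
      simpa using hconst
  · intro hoss X Y hX hY μ hμ
    have hXX : ⟪X, X⟫ = (1:ℝ) := by rw [real_inner_self_eq_norm_sq, hX]; norm_num
    have hYY : ⟪Y, Y⟫ = (1:ℝ) := by rw [real_inner_self_eq_norm_sq, hY]; norm_num
    have hY0 : Y ≠ 0 := by rintro rfl; simp at hY
    have key : ∀ Z, ⟪Z, Z⟫ = (1:ℝ) → ⟪X, Z⟫ = (0:ℝ) → ⟪J Y X, Z⟫ = (0:ℝ) := by
      intro Z hZZ hXZ
      have hZX : ⟪Z, X⟫ = (0:ℝ) := by rw [real_inner_comm, hXZ]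
      obtain ⟨A, hA⟩ : ∃ A : ℝ → E →ₗ[ℝ] E, ∀ t, A t = J (Real.cos t • X + Real.sin t • Z) :=
        ⟨_, fun _ => rfl⟩
      have hAc : ∀ t, (A t).charpoly = (J X).charpoly := by
        intro t
        rw [hA]
        apply hoss _ _ _ hX
        have : ‖Real.cos t • X + Real.sin t • Z‖ ^ 2 = 1 := by
          rw [← real_inner_self_eq_norm_sq]
          simp only [inner_add_left, inner_add_right, inner_smul_left, inner_smul_right,
            hXX, hXZ, hZX, hZZ]
          have := Real.sin_sq_add_cos_sq t
          simp; nlinarith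
        exact (pow_eq_one_iff_of_nonneg (norm_nonneg _) two_ne_zero).1 this
      have hAs : ∀ t, (A t).IsSymmetric := fun t => by rw [hA]; exact hsym _
      obtain ⟨S, hS⟩ : ∃ S : Finset ℝ, S = (J X).charpoly.roots.toFinset := ⟨_, rfl⟩
      have hμS : μ ∈ S := by
        rw [hS, Multiset.mem_toFinset, Polynomial.mem_roots (LinearMap.charpoly_monic _).ne_zero]
        refine (Module.End.hasEigenvalue_iff_isRoot_charpoly _ _).1 ?_
        exact Module.End.hasEigenvalue_of_hasEigenvector
          ⟨Module.End.mem_eigenspace_iff.2 hμ, hY0⟩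
      obtain ⟨q, hq⟩ : ∃ q : Polynomial ℝ,
        q = ∏ r ∈ S.erase μ, (Polynomial.X - Polynomial.C r) := ⟨_, rfl⟩
      have hqμ : q.eval μ ≠ 0 := by
        rw [hq, Polynomial.eval_prod, Finset.prod_ne_zero_iff]
        intro r hr
        have := Finset.ne_of_mem_erase hr
        simpa [sub_eq_zero] using this.symm
      have hann : ∀ t, ∀ V, A t (Polynomial.aeval (A t) q V) - μ • Polynomial.aeval (A t) q V = 0 := by
        intro t V
        have h := aux_annih (A t) (hAs t)
        rw [hAc, ← hS, ← Finset.mul_prod_erase S _ hμS, ← hq] at h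
        have h2 := congrArg (fun T : E →ₗ[ℝ] E => T V) h
        simpa [Module.algebraMap_end_apply] using h2
      have hcont : ∀ (p : Polynomial ℝ) (y : ℝ → E), Continuous y →
          Continuous (fun t => Polynomial.aeval (A t) p (y t)) := by
        intro p
        induction p using Polynomial.induction_on with
        | C a => 
          intro y hy
          simp only [Polynomial.aeval_C, Module.algebraMap_end_apply]
          fun_prop
        | add p q hp hq =>
          intro y hy
          simp only [map_add, LinearMap.add_apply]
          exact (hp y hy).add (hq y hy)
        | monomial n a ih =>
          intro y hy
          have h1 : Continuous (fun t => A t (y t)) := by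
            simp only [hA, hJq]
            have c1 := (LinearMap.continuous_of_finiteDimensional (J X)).comp hy
            have c2 := (LinearMap.continuous_of_finiteDimensional (K X Z)).comp hy
            have c3 := (LinearMap.continuous_of_finiteDimensional (J Z)).comp hy
            simp only [Function.comp_def] at c1 c2 c3
            fun_prop
          have := ih _ h1
          simpa only [pow_succ, ← mul_assoc, map_mul, Polynomial.aeval_X, Module.End.mul_apply]
            using this
      obtain ⟨F, hF⟩ : ∃ F : ℝ → ℝ, ∀ t, F t = ⟪Polynomial.aeval (A t) q Y,
        Real.cos t • K X Z Y + Real.sin t • (J Z Y - μ • Y)⟫ := ⟨_, fun _ => rfl⟩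
      have hFc : Continuous F := by
        rw [funext hF]
        exact (hcont q _ continuous_const).inner (by fun_prop)
      have hF1 : ∀ t, Real.sin t * F t = 0 := by
        intro t
        have h1 : A t Y - μ • Y =
            Real.sin t • (Real.cos t • K X Z Y + Real.sin t • (J Z Y - μ • Y)) := by
          rw [hA, hJq, hμ, Real.cos_sq']
          module
        rw [hF, ← inner_smul_right, ← h1, inner_sub_right, ← hAs t, inner_smul_right,
          ← real_inner_smul_left, ← inner_sub_left, hann, inner_zero_left]
      have hF0 : F 0 = 0 := by
        have h1 : Filter.Tendsto F (nhdsWithin 0 (Set.Ioi 0)) (nhds (F 0)) :=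
          hFc.continuousAt.mono_left nhdsWithin_le_nhds
        have h2 : ∀ᶠ t in nhdsWithin (0:ℝ) (Set.Ioi 0), F t = 0 := by
          filter_upwards [Ioo_mem_nhdsGT Real.pi_pos] with t ht
          exact (mul_eq_zero.1 (hF1 t)).resolve_left (Real.sin_pos_of_pos_of_lt_pi ht.1 ht.2).ne'
        exact tendsto_nhds_unique h1 ((Filter.tendsto_congr' h2).2 tendsto_const_nhds)
      have hA0 : A 0 = J X := by rw [hA]; simp
      rw [hF, hA0, aux_aeval _ _ _ hμ, real_inner_smul_left] at hF0
      have h3 := (mul_eq_zero.1 hF0).resolve_left hqμ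
      simp only [Real.cos_zero, Real.sin_zero, one_smul, zero_smul, add_zero] at h3
      rw [real_inner_comm, hKd] at h3
      linarith
    have key2 : ∀ Z, ⟪X, Z⟫ = (0:ℝ) → ⟪J Y X, Z⟫ = (0:ℝ) := by
      intro Z hZ
      by_cases hZ0 : Z = 0
      · simp [hZ0]
      · have hn : ‖Z‖ ≠ 0 := norm_ne_zero_iff.2 hZ0
        have := key (‖Z‖⁻¹ • Z) (by
          rw [inner_smul_right, inner_smul_left, real_inner_self_eq_norm_sq]
          simp; field_simp) (by rw [inner_smul_right, hZ, mul_zero])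
        rw [inner_smul_right] at this
        exact (mul_eq_zero.1 this).resolve_left (inv_ne_zero hn)
    have hself : ⟪J Y X, X⟫ = μ := by
      rw [hJ, hrev, ← hJ, hμ, real_inner_smul_left, hYY, mul_one]
    apply ext_inner_right ℝ
    intro V
    have h := key2 (V - ⟪X, V⟫ • X) (by
      rw [inner_sub_right, inner_smul_right, hXX]; ring)
    rw [inner_sub_right, inner_smul_right, hself] at h
    rw [real_inner_smul_left]
    linarith
end

section
/- Let E be a finite-dimensional real inner product space of dimension at least 2, and let R be an algebraic curvature tensor on E with associated Jacobi operators J_X. If R satisfies the Rakić duality principle — i.e., for all unit vectors X, Y in E and every real λ, J_X Y = λY implies J_Y X = λX — then R is Osserman: the characteristic polynomial of J_X is the same for all unit vectors X in E. -/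
open RealInnerProductSpace

theorem det_deriv_aux {ι : Type*} [Fintype ι] [DecidableEq ι]
    (M : ℝ → Matrix ι ι ℝ) (M' : Matrix ι ι ℝ) (t : ℝ)
    (hM : ∀ i j, HasDerivAt (fun u => M u i j) (M' i j) t)
    (hoff : ∀ i j, i ≠ j → M t i j = 0) (hdiag : ∀ i, M' i i = 0) :
    HasDerivAt (fun u => (M u).det) 0 t := by
  simp only [Matrix.det_apply']
  have key : ∀ σ : Equiv.Perm ι,
      HasDerivAt (fun u => ((Equiv.Perm.sign σ : ℤ) : ℝ) * ∏ i, M u (σ i) i) 0 t := by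
    intro σ
    have h := HasDerivAt.fun_finsetProd (u := Finset.univ) (f := fun i u => M u (σ i) i)
      (f' := fun i => M' (σ i) i) (x := t) (fun i _ => hM (σ i) i)
    have h2 := h.const_mul ((Equiv.Perm.sign σ : ℤ) : ℝ)
    refine h2.congr_deriv ?_
    apply mul_eq_zero_of_right
    apply Finset.sum_eq_zero
    intro i _
    by_cases hi : σ i = i
    · simp [hi, hdiag]
    · have : ∏ j ∈ Finset.univ.erase i, M t (σ j) j = 0 := by
        apply Finset.prod_eq_zero (i := σ i)
        · simp [hi]
        · apply hoff
          intro h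
          exact hi (σ.injective h)
      simp [this]
  have := HasDerivAt.fun_sum (u := Finset.univ) (fun σ _ => key σ)
  simpa using this

/-- For an algebraic curvature tensor `R` on a finite-dimensional real inner
product space `E` of dimension at least 2, with Jacobi operators `J X` determined by
`⟪J X Y, Z⟫ = R Y X X Z`, the Rakić duality principle implies the Osserman condition:
the characteristic polynomial of `J X` is the same for all unit vectors `X`. -/
theorem osserman_of_duality
    {E : Type*} [NormedAddCommGroup E] [InnerProductSpace ℝ E] [FiniteDimensional ℝ E]
    (hdim : 2 ≤ Module.finrank ℝ E)
    (R : E → E → E → E → ℝ)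
    (hlin1 : ∀ Y Z W, IsLinearMap ℝ (fun X => R X Y Z W))
    (hlin2 : ∀ X Z W, IsLinearMap ℝ (fun Y => R X Y Z W))
    (hlin3 : ∀ X Y W, IsLinearMap ℝ (fun Z => R X Y Z W))
    (hlin4 : ∀ X Y Z, IsLinearMap ℝ (fun W => R X Y Z W))
    (hanti : ∀ X Y Z W, R X Y Z W = - R Y X Z W)
    (hpair : ∀ X Y Z W, R X Y Z W = R Z W X Y)
    (hbianchi : ∀ X Y Z W, R X Y Z W + R Y Z X W + R Z X Y W = 0)
    (J : E → E →ₗ[ℝ] E)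
    (hJ : ∀ X Y Z : E, ⟪J X Y, Z⟫ = R Y X X Z)
    (hduality : ∀ X Y : E, ‖X‖ = 1 → ‖Y‖ = 1 → ∀ μ : ℝ, J X Y = μ • Y → J Y X = μ • X) :
    ∀ X Y : E, ‖X‖ = 1 → ‖Y‖ = 1 → (J X).charpoly = (J Y).charpoly := by
  have hR4 : ∀ A B C D, R A B C D = - R A B D C := fun A B C D => by
    rw [hpair A B C D, hanti C D A B, hpair D C A B]
  have hsw : ∀ A B C D, R A B C D = R D C B A := fun A B C D => by
    rw [hpair A B C D, hanti C D A B, hR4 D C A B]; ring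
  have hsymm : ∀ X, (J X).IsSymmetric := by
    intro X a b
    rw [hJ, real_inner_comm, hJ, hsw]
  -- the circle argument
  have circ : ∀ X Z : E, ‖X‖ = 1 → ‖Z‖ = 1 → ⟪X, Z⟫ = 0 → ∀ t : ℝ,
      (J (Real.cos t • X + Real.sin t • Z)).charpoly = (J X).charpoly := by
    intro X Z hX hZ hXZ t
    have hXX : ⟪X, X⟫ = 1 := by rw [real_inner_self_eq_norm_sq, hX]; norm_num
    have hZZ : ⟪Z, Z⟫ = 1 := by rw [real_inner_self_eq_norm_sq, hZ]; norm_num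
    have hZX : ⟪Z, X⟫ = 0 := by rw [real_inner_comm, hXZ]
    set γ : ℝ → E := fun t => Real.cos t • X + Real.sin t • Z with hγ
    set γ' : ℝ → E := fun t => (-Real.sin t) • X + Real.cos t • Z with hγ'
    have hγn : ∀ t, ‖γ t‖ = 1 := by
      intro t
      have : ‖γ t‖ ^ 2 = 1 := by
        rw [← real_inner_self_eq_norm_sq]
        simp only [hγ, inner_add_left, inner_add_right, real_inner_smul_left,
          real_inner_smul_right, hXX, hZZ, hXZ, hZX]
        nlinarith [Real.sin_sq_add_cos_sq t]
      nlinarith [norm_nonneg (γ t)]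
    have hγγ' : ∀ t, ⟪γ t, γ' t⟫ = 0 := by
      intro t
      simp only [hγ, hγ', inner_add_left, inner_add_right, real_inner_smul_left,
          real_inner_smul_right, hXX, hZZ, hXZ, hZX]
      ring
    have hexp : ∀ A B (a b c d : ℝ), R A (a • X + b • Z) (c • X + d • Z) B =
        a * c * R A X X B + a * d * R A X Z B + b * c * R A Z X B + b * d * R A Z Z B := by
      intro A B a b c d
      have h2 := fun C => (hlin2 A C B).map_add
      have h2' := fun C => (hlin2 A C B).map_smul
      have h3 := fun C => (hlin3 A C B).map_add
      have h3' := fun C => (hlin3 A C B).map_smul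
      simp only [smul_eq_mul] at h2 h2' h3 h3'
      rw [h2, h2', h2', h3, h3, h3', h3', h3', h3']
      ring
    have hder : ∀ A B t, HasDerivAt (fun u => R A (γ u) (γ u) B)
        (R A (γ' t) (γ t) B + R A (γ t) (γ' t) B) t := by
      intro A B t
      simp only [hγ, hγ', hexp]
      have hc := Real.hasDerivAt_cos t
      have hs := Real.hasDerivAt_sin t
      have := ((((hc.mul hc).mul_const (R A X X B)).add ((hc.mul hs).mul_const (R A X Z B))).add
        ((hs.mul hc).mul_const (R A Z X B))).add ((hs.mul hs).mul_const (R A Z Z B))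
      refine HasDerivAt.congr_deriv (this.congr_of_eventuallyEq (Filter.Eventually.of_forall ?_)) ?_
      · intro u
        rfl
      · ring
    apply Polynomial.funext
    intro s
    have hconst : ∀ t, HasDerivAt (fun u => (J (γ u)).charpoly.eval s) 0 t := by
      intro t
      set e := (hsymm (γ t)).eigenvectorBasis rfl with he
      set lam := (hsymm (γ t)).eigenvalues rfl with hlam
      have heig : ∀ i, J (γ t) (e i) = lam i • e i := by
        intro i
        have := (hsymm (γ t)).apply_eigenvectorBasis rfl i
        exact this
      have hent : ∀ u i j, LinearMap.toMatrix e.toBasis e.toBasis (J (γ u)) i j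
          = R (e j) (γ u) (γ u) (e i) := by
        intro u i j
        rw [LinearMap.toMatrix_apply, ← hJ]
        simp [OrthonormalBasis.repr_apply_apply, real_inner_comm]
      have hev : ∀ u, (J (γ u)).charpoly.eval s =
          (Matrix.scalar _ s - LinearMap.toMatrix e.toBasis e.toBasis (J (γ u))).det := by
        intro u
        rw [← LinearMap.charpoly_toMatrix (J (γ u)) e.toBasis, Matrix.eval_charpoly]
      simp only [hev]
      apply det_deriv_aux _ (fun i j => - (R (e j) (γ' t) (γ t) (e i) + R (e j) (γ t) (γ' t) (e i)))
      · intro i j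
        simp only [Matrix.sub_apply, hent]
        exact (hder (e j) (e i) t).const_sub _
      · intro i j hij
        rw [Matrix.sub_apply, hent, ← hJ, heig, real_inner_smul_left,
          e.orthonormal.2 (Ne.symm hij)]
        simp [hij]
      · intro i
        have hd := hduality (γ t) (e i) (hγn t) (e.orthonormal.1 i) (lam i) (heig i)
        have h0 : R (γ t) (e i) (e i) (γ' t) = 0 := by
          rw [← hJ, hd, real_inner_smul_left, hγγ', mul_zero]
        have h1 : R (e i) (γ' t) (γ t) (e i) = 0 := by rw [hpair, h0]
        have h2 : R (e i) (γ t) (γ' t) (e i) = 0 := by rw [hsw, h1]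
        simp only [h1, h2]; simp
    have := is_const_of_deriv_eq_zero (fun t => (hconst t).differentiableAt)
      (fun t => (hconst t).deriv) t 0
    simpa [hγ] using this
  intro X Y hX hY
  have hXX : ⟪X, X⟫ = 1 := by rw [real_inner_self_eq_norm_sq, hX]; norm_num
  have hYY : ⟪Y, Y⟫ = 1 := by rw [real_inner_self_eq_norm_sq, hY]; norm_num
  set c : ℝ := ⟪X, Y⟫ with hc
  have hYX : ⟪Y, X⟫ = c := by rw [real_inner_comm]
  have hn2 : ‖Y - c • X‖ ^ 2 = 1 - c ^ 2 := by
    rw [← real_inner_self_eq_norm_sq]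
    simp only [inner_sub_left, inner_sub_right, real_inner_smul_left,
          real_inner_smul_right, hXX, hYY, ← hc, hYX]
    ring
  by_cases hW : Y - c • X = 0
  · have hYc : Y = c • X := sub_eq_zero.1 hW
    have hc2 : c * c = 1 := by
      rw [hW, norm_zero] at hn2; linarith
    have : J X = J Y := by
      ext v
      apply ext_inner_right ℝ
      intro w
      have h2 := (hlin2 v (c • X) w).map_smul c X
      have h3 := (hlin3 v X w).map_smul c X
      simp only [smul_eq_mul] at h2 h3
      rw [hJ, hJ, hYc, h2, h3, ← mul_assoc, hc2, one_mul]
    rw [this]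
  · set n := ‖Y - c • X‖ with hn
    have hn0 : 0 < n := norm_pos_iff.2 hW
    have hcs : Real.cos (Real.arccos c) = c :=
      Real.cos_arccos (by nlinarith) (by nlinarith)
    have hsn : Real.sin (Real.arccos c) = n := by
      rw [Real.sin_arccos, ← hn2, Real.sqrt_sq hn0.le]
    have h := circ X (n⁻¹ • (Y - c • X)) hX
      (by rw [norm_smul, norm_inv, Real.norm_of_nonneg hn0.le, ← hn, inv_mul_cancel₀ hn0.ne'])
      (by rw [real_inner_smul_right, inner_sub_right, real_inner_smul_right, hXX, ← hc]; ring)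
      (Real.arccos c)
    rw [hcs, hsn, smul_smul, mul_inv_cancel₀ hn0.ne', one_smul, add_sub_cancel] at h
    exact h.symm
end

section
/- Let E be a finite-dimensional real inner product space of dimension at least 2, and let R be an algebraic curvature tensor on E with associated Jacobi operators J_X. If R is Osserman — i.e., the characteristic polynomial of J_X is the same for all unit vectors X — then R satisfies the Rakić duality principle: for all unit vectors X, Y in E and every real λ, if J_X Y = λY then J_Y X = λX. -/
open RealInnerProductSpace

theorem aux_finrank_eigenspace {E : Type*} [NormedAddCommGroup E] [InnerProductSpace ℝ E]
    [FiniteDimensional ℝ E] (T : E →ₗ[ℝ] E) (hT : T.IsSymmetric) (μ : ℝ) :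
    Module.finrank ℝ (Module.End.eigenspace T μ) = T.charpoly.rootMultiplicity μ := by
  rw [← LinearMap.finrank_maxGenEigenspace_eq,
    hT.isFinitelySemisimple.maxGenEigenspace_eq_eigenspace]

theorem aux_inter {E : Type*} [NormedAddCommGroup E] [InnerProductSpace ℝ E]
    [FiniteDimensional ℝ E] (K K' : Submodule ℝ E)
    (h : Module.finrank ℝ K' = Module.finrank ℝ K) (Y : E) (hY : Y ∈ K) (hY1 : ‖Y‖ = 1) :
    ∃ w ∈ K', w ∈ Kᗮ ⊔ Submodule.span ℝ {Y} ∧ ‖w‖ = 1 := by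
  have hY0 : Y ≠ 0 := by rintro rfl; simp at hY1
  have h1 := Submodule.finrank_add_finrank_orthogonal K
  have hd : Disjoint Kᗮ (Submodule.span ℝ {Y}) := by
    refine Disjoint.mono_right ?_ (Submodule.orthogonal_disjoint K).symm
    simpa [Submodule.span_le] using hY
  have h2 := Submodule.finrank_sup_add_finrank_inf_eq Kᗮ (Submodule.span ℝ {Y})
  rw [hd.eq_bot, finrank_bot, finrank_span_singleton hY0] at h2
  have h3 := Submodule.finrank_sup_add_finrank_inf_eq K' (Kᗮ ⊔ Submodule.span ℝ {Y})
  have h4 := Submodule.finrank_le (K' ⊔ (Kᗮ ⊔ Submodule.span ℝ {Y}))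
  have h5 : K' ⊓ (Kᗮ ⊔ Submodule.span ℝ {Y}) ≠ ⊥ := by
    intro h0
    rw [h0, finrank_bot] at h3
    omega
  obtain ⟨v, hv, hv0⟩ := Submodule.exists_mem_ne_zero_of_ne_bot h5
  refine ⟨‖v‖⁻¹ • v, K'.smul_mem _ hv.1, Submodule.smul_mem _ _ hv.2, ?_⟩
  rw [norm_smul, norm_inv, norm_norm, inv_mul_cancel₀ (norm_ne_zero_iff.2 hv0)]

/-- For an algebraic curvature tensor `R` on a finite-dimensional real inner
product space `E` of dimension at least 2, with Jacobi operators `J X` determined by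
`⟪J X Y, Z⟫ = R Y X X Z`, the Osserman condition implies the Rakić duality principle. -/
theorem duality_of_osserman
    {E : Type*} [NormedAddCommGroup E] [InnerProductSpace ℝ E] [FiniteDimensional ℝ E]
    (hdim : 2 ≤ Module.finrank ℝ E)
    (R : E → E → E → E → ℝ)
    (hlin1 : ∀ Y Z W, IsLinearMap ℝ (fun X => R X Y Z W))
    (hlin2 : ∀ X Z W, IsLinearMap ℝ (fun Y => R X Y Z W))
    (hlin3 : ∀ X Y W, IsLinearMap ℝ (fun Z => R X Y Z W))
    (hlin4 : ∀ X Y Z, IsLinearMap ℝ (fun W => R X Y Z W))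
    (hanti : ∀ X Y Z W, R X Y Z W = - R Y X Z W)
    (hpair : ∀ X Y Z W, R X Y Z W = R Z W X Y)
    (hbianchi : ∀ X Y Z W, R X Y Z W + R Y Z X W + R Z X Y W = 0)
    (J : E → E →ₗ[ℝ] E)
    (hJ : ∀ X Y Z : E, ⟪J X Y, Z⟫ = R Y X X Z)
    (hosserman : ∀ X Y : E, ‖X‖ = 1 → ‖Y‖ = 1 → (J X).charpoly = (J Y).charpoly) :
    ∀ X Y : E, ‖X‖ = 1 → ‖Y‖ = 1 → ∀ μ : ℝ, J X Y = μ • Y → J Y X = μ • X := by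
  intro X Y hX hY μ hXY
  have hsymm : ∀ X, (J X).IsSymmetric := by
    intro X A B
    rw [hJ, real_inner_comm, hJ]
    linarith [hpair A X X B, hanti X B A X, hpair B X A X, hanti A X B X, hpair X A B X]
  have hK : Y ∈ Module.End.eigenspace (J X) μ := Module.End.mem_eigenspace_iff.2 hXY
  set K := Module.End.eigenspace (J X) μ with hKdef
  refine ext_inner_right ℝ fun Z => ?_
  have hexp : ∀ (s : ℝ) (w V : E), ⟪J (X + s • Z) w, V⟫ =
      R w X X V + s * (R w X Z V + R w Z X V) + s ^ 2 * R w Z Z V := by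
    intro s w V
    rw [hJ]
    have e2 : ∀ A B D F G : E, R A (B + s • D) F G = R A B F G + s * R A D F G := fun A B D F G => by
      rw [(hlin2 A F G).map_add, (hlin2 A F G).map_smul, smul_eq_mul]
    have e3 : ∀ A B D F G : E, R A B (D + s • F) G = R A B D G + s * R A B F G := fun A B D F G => by
      rw [(hlin3 A B G).map_add, (hlin3 A B G).map_smul, smul_eq_mul]
    rw [e2, e3, e3]; ring
  have hnorm : ∀ s : ℝ, ‖X + s • Z‖ ^ 2 = 1 + 2 * s * ⟪X, Z⟫ + s ^ 2 * ‖Z‖ ^ 2 := by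
    intro s
    rw [norm_add_sq_real, hX, norm_smul, inner_smul_right, mul_pow, Real.norm_eq_abs, sq_abs]
    ring
  have hscale : ∀ (c : ℝ) (U w : E), J (c • U) w = c ^ 2 • J U w := by
    intro c U w
    refine ext_inner_right ℝ fun V => ?_
    rw [inner_smul_left, hJ, hJ, (hlin2 _ _ _).map_smul, (hlin3 _ _ _).map_smul]
    simp; ring
  have hex : ∀ s : ℝ, ∃ w, w ∈ Kᗮ ⊔ Submodule.span ℝ {Y} ∧ ‖w‖ = 1 ∧
      J (X + s • Z) w = (‖X + s • Z‖ ^ 2 * μ) • w := by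
    intro s
    set U := X + s • Z
    by_cases hU : U = 0
    · refine ⟨Y, Submodule.mem_sup_right (Submodule.mem_span_singleton_self Y), hY, ?_⟩
      have := hscale 0 0 Y
      rw [hU]
      simpa using this
    · have hU' : ‖U‖ ≠ 0 := norm_ne_zero_iff.2 hU
      have hu : ‖‖U‖⁻¹ • U‖ = 1 := by
        rw [norm_smul, norm_inv, norm_norm, inv_mul_cancel₀ hU']
      obtain ⟨w, hw, hw2, hw3⟩ := aux_inter K (Module.End.eigenspace (J (‖U‖⁻¹ • U)) μ)
        (by rw [hKdef, aux_finrank_eigenspace _ (hsymm _), aux_finrank_eigenspace _ (hsymm _),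
              hosserman _ _ hu hX]) Y hK hY
      refine ⟨w, hw2, hw3, ?_⟩
      rw [Module.End.mem_eigenspace_iff, hscale] at hw
      rw [mul_smul, ← hw, smul_smul, inv_pow, mul_inv_cancel₀ (pow_ne_zero 2 hU'), one_smul]
  choose w hwW hw1 hwJ using fun n : ℕ => hex (1 / ((n : ℝ) + 1))
  obtain ⟨v, hv, φ, hφ, hlim⟩ := (isCompact_sphere (0 : E) 1).tendsto_subseq
    (x := w) (fun n => by simp [hw1])
  have hv1 : ‖v‖ = 1 := by simpa using hv
  have hs : Filter.Tendsto (fun n => 1 / ((φ n : ℝ) + 1)) Filter.atTop (nhds 0) :=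
    (tendsto_one_div_add_atTop_nhds_zero_nat (𝕜 := ℝ)).comp hφ.tendsto_atTop
  have hcont : ∀ A B D : E, Filter.Tendsto (fun n => R (w (φ n)) A B D) Filter.atTop
      (nhds (R v A B D)) := by
    intro A B D
    have hc : Continuous (fun x => R x A B D) :=
      ((hlin1 A B D).mk' _).continuous_of_finiteDimensional
    exact (hc.tendsto v).comp hlim
  have hinn : ∀ V : E, Filter.Tendsto (fun n => ⟪w (φ n), V⟫) Filter.atTop
      (nhds ⟪v, V⟫) := fun V => Filter.Tendsto.inner hlim tendsto_const_nhds
  have hmain : ∀ (V : E) (n : ℕ), R (w n) X X V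
      + (1 / ((n : ℝ) + 1)) * (R (w n) X Z V + R (w n) Z X V)
      + (1 / ((n : ℝ) + 1)) ^ 2 * R (w n) Z Z V
      = (1 + 2 * (1 / ((n : ℝ) + 1)) * ⟪X, Z⟫ + (1 / ((n : ℝ) + 1)) ^ 2 * ‖Z‖ ^ 2)
        * μ * ⟪w n, V⟫ := by
    intro V n
    rw [← hexp, hwJ, inner_smul_left, ← hnorm]
    simp
  have hvK : v ∈ K := by
    rw [hKdef, Module.End.mem_eigenspace_iff]
    refine ext_inner_right ℝ fun V => ?_
    rw [hJ, inner_smul_left]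
    have l1 := ((hcont X X V).add (hs.mul ((hcont X Z V).add (hcont Z X V)))).add
      ((hs.pow 2).mul (hcont Z Z V))
    have l2 := ((((tendsto_const_nhds (x := (1 : ℝ))).add
      ((hs.const_mul 2).mul_const ⟪X, Z⟫)).add
      ((hs.pow 2).mul_const (‖Z‖ ^ 2))).mul_const μ).mul (hinn V)
    have := tendsto_nhds_unique l1 (l2.congr fun n => (hmain V (φ n)).symm)
    simpa using this
  have hvW : v ∈ Kᗮ ⊔ Submodule.span ℝ {Y} :=
    (Submodule.closed_of_finiteDimensional _).mem_of_tendsto hlim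
      (Filter.Eventually.of_forall fun n => hwW _)
  obtain ⟨a, ha, b, hb, hab⟩ := Submodule.mem_sup.1 hvW
  obtain ⟨c, rfl⟩ := Submodule.mem_span_singleton.1 hb
  have haK : a ∈ K := by
    have : a = v - c • Y := by rw [← hab]; simp
    rw [this]; exact K.sub_mem hvK (K.smul_mem _ hK)
  have ha0 : a = 0 := by
    have := ha a haK
    simpa using this
  rw [ha0, zero_add] at hab
  have hc0 : c ≠ 0 := by
    rintro rfl
    rw [← hab] at hv1
    simp at hv1
  have hdiv : ∀ n : ℕ, (R (w n) X Z Y + R (w n) Z X Y) + (1 / ((n : ℝ) + 1)) * R (w n) Z Z Y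
      = (2 * ⟪X, Z⟫ + (1 / ((n : ℝ) + 1)) * ‖Z‖ ^ 2) * μ * ⟪w n, Y⟫ := by
    intro n
    have h1 := hmain Y n
    have h2 : R (w n) X X Y = μ * ⟪w n, Y⟫ := by
      rw [← hJ, hsymm X, hXY, inner_smul_right]
    rw [h2] at h1
    have hp : (1 / ((n : ℝ) + 1)) ≠ 0 := by positivity
    apply mul_left_cancel₀ hp
    linear_combination h1
  have l1 := ((hcont X Z Y).add (hcont Z X Y)).add (hs.mul (hcont Z Z Y))
  have l2 := (((tendsto_const_nhds (x := 2 * ⟪X, Z⟫)).add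
      (hs.mul_const (‖Z‖ ^ 2))).mul_const μ).mul (hinn Y)
  have hfin := tendsto_nhds_unique l1 (l2.congr fun n => (hdiv (φ n)).symm)
  rw [← hab, (hlin1 _ _ _).map_smul, (hlin1 _ _ _).map_smul, inner_smul_left,
    real_inner_self_eq_norm_sq, hY, hpair Y X Z Y, hpair Y Z X Y, ← hJ, ← hJ, hsymm Y Z X,
    real_inner_comm] at hfin
  simp only [smul_eq_mul, zero_mul, add_zero, conj_trivial, one_pow, mul_one] at hfin
  rw [inner_smul_left]
  apply mul_left_cancel₀ hc0
  simp only [conj_trivial]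
  linear_combination hfin / 2
end

section
/- Let E be a finite-dimensional real inner product space of dimension at least 2, and let R be an algebraic curvature tensor on E with associated Jacobi operators J_X, satisfying the Rakić duality principle: for all unit vectors X, Y in E and every real λ, J_X Y = λY implies J_Y X = λX. Let X and Y be orthogonal unit vectors in E, let λ : ℝ → ℝ and e : ℝ → E be differentiable functions such that for all φ in a neighbourhood of 0, ‖e(φ)‖ = 1 and J_{cos(φ)X + sin(φ)Y} e(φ) = λ(φ) e(φ). Then λ'(0) = 0. -/
open RealInnerProductSpace

open Real

/-- If the algebraic curvature tensor `R` satisfies the Rakić duality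
principle, `X, Y` are orthogonal unit vectors, and `lam : ℝ → ℝ`, `e : ℝ → E` are
differentiable with `‖e φ‖ = 1` and `J (cos φ • X + sin φ • Y) (e φ) = lam φ • e φ`
for all `φ` near `0`, then `lam' (0) = 0`. -/
theorem deriv_eigenvalue_eq_zero
    {E : Type*} [NormedAddCommGroup E] [InnerProductSpace ℝ E] [FiniteDimensional ℝ E]
    (hdim : 2 ≤ Module.finrank ℝ E)
    (R : E → E → E → E → ℝ)
    (hlin1 : ∀ Y Z W, IsLinearMap ℝ (fun X => R X Y Z W))
    (hlin2 : ∀ X Z W, IsLinearMap ℝ (fun Y => R X Y Z W))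
    (hlin3 : ∀ X Y W, IsLinearMap ℝ (fun Z => R X Y Z W))
    (hlin4 : ∀ X Y Z, IsLinearMap ℝ (fun W => R X Y Z W))
    (hanti : ∀ X Y Z W, R X Y Z W = - R Y X Z W)
    (hpair : ∀ X Y Z W, R X Y Z W = R Z W X Y)
    (hbianchi : ∀ X Y Z W, R X Y Z W + R Y Z X W + R Z X Y W = 0)
    (J : E → E →ₗ[ℝ] E)
    (hJ : ∀ X Y Z : E, ⟪J X Y, Z⟫ = R Y X X Z)
    (hduality : ∀ X Y : E, ‖X‖ = 1 → ‖Y‖ = 1 → ∀ μ : ℝ, J X Y = μ • Y → J Y X = μ • X)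
    (X Y : E) (hX : ‖X‖ = 1) (hY : ‖Y‖ = 1) (hXY : ⟪X, Y⟫ = 0)
    (lam : ℝ → ℝ) (e : ℝ → E)
    (hlam : Differentiable ℝ lam) (he : Differentiable ℝ e)
    (heigen : ∀ᶠ φ in nhds (0 : ℝ),
      ‖e φ‖ = 1 ∧ J (cos φ • X + sin φ • Y) (e φ) = lam φ • e φ) :
    deriv lam 0 = 0 := by
  have hsym : ∀ a x b : E, R a x x b = R b x x a := by
    intro a x b
    have h1 := hpair a x x b
    have h2 := hanti x b a x
    have h3 := hpair b x a x
    have h4 := hanti a x b x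
    have h5 := hpair x a b x
    linarith
  have hxy : ∀ a x y b : E, R a x y b = R b y x a := by
    intro a x y b
    have h1 := hpair a x y b
    have h2 := hanti y b a x
    have h3 := hpair b y a x
    have h4 := hanti a x b y
    have h5 := hpair x a b y
    linarith
  have hexp : ∀ (a b : E) (c s : ℝ), R a (c • X + s • Y) (c • X + s • Y) b
      = c ^ 2 * R a X X b + c * s * (R a X Y b + R a Y X b) + s ^ 2 * R a Y Y b := by
    intro a b c s
    have e1 := (hlin2 a (c • X + s • Y) b).map_add (c • X) (s • Y)
    have e2 := (hlin2 a (c • X + s • Y) b).map_smul c X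
    have e3 := (hlin2 a (c • X + s • Y) b).map_smul s Y
    have f1 := (hlin3 a X b).map_add (c • X) (s • Y)
    have f2 := (hlin3 a X b).map_smul c X
    have f3 := (hlin3 a X b).map_smul s Y
    have g1 := (hlin3 a Y b).map_add (c • X) (s • Y)
    have g2 := (hlin3 a Y b).map_smul c X
    have g3 := (hlin3 a Y b).map_smul s Y
    simp only [smul_eq_mul] at e1 e2 e3 f1 f2 f3 g1 g2 g3
    rw [e1, e2, e3, f1, f2, f3, g1, g2, g3]
    ring
  have hdiff : ∀ x y b : E, DifferentiableAt ℝ (fun φ => R (e φ) x y b) 0 := by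
    intro x y b
    exact ((LinearMap.toContinuousLinearMap
      (IsLinearMap.mk' _ (hlin1 x y b))).differentiableAt).comp (0 : ℝ) (he 0)
  obtain ⟨hn0, hev0⟩ := heigen.self_of_nhds
  simp only [cos_zero, sin_zero, one_smul, zero_smul, add_zero] at hev0
  have hdual := hduality X (e 0) hX hn0 _ hev0
  have hp0 : R (e 0) X Y (e 0) + R (e 0) Y X (e 0) = 0 := by
    have h1 := hxy (e 0) X Y (e 0)
    have h2 := hJ (e 0) X Y
    rw [hdual, inner_smul_left, hXY, mul_zero] at h2
    have h3 := hanti X (e 0) (e 0) Y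
    have h4 := hpair (e 0) X (e 0) Y
    have h5 := hanti (e 0) Y (e 0) X
    have h6 := hpair Y (e 0) (e 0) X
    linarith
  have hA : ∀ φ, R (e φ) X X (e 0) = lam 0 * ⟪e φ, e 0⟫ := by
    intro φ
    rw [hsym, ← hJ, hev0, real_inner_smul_left, real_inner_comm]
  have hg : HasDerivAt (fun φ => ⟪e φ, e 0⟫) ⟪deriv e 0, e 0⟫ 0 := by
    simpa using (he 0).hasDerivAt.inner ℝ (hasDerivAt_const (0 : ℝ) (e 0))
  have hg0 : ⟪e 0, e 0⟫ = 1 := by rw [real_inner_self_eq_norm_sq, hn0]; norm_num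
  have hL := (hlam 0).hasDerivAt.mul hg
  have hR := ((((hasDerivAt_cos 0).pow 2).mul (hg.const_mul (lam 0))).add
    (((hasDerivAt_cos 0).mul (hasDerivAt_sin 0)).mul
      ((hdiff X Y (e 0)).hasDerivAt.add (hdiff Y X (e 0)).hasDerivAt))).add
    (((hasDerivAt_sin 0).pow 2).mul (hdiff Y Y (e 0)).hasDerivAt)
  have hu := (hL.congr_of_eventuallyEq (f₁ := _) (by
    filter_upwards [heigen] with φ hφ
    have h := hJ (cos φ • X + sin φ • Y) (e φ) (e 0)
    rw [hφ.2, real_inner_smul_left, hexp, hA] at h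
    exact h.symm)).unique hR
  simp [hn0] at hu
  linarith
end

section
/- Let E be a finite-dimensional real inner product space of dimension at least 2, and let R be an algebraic curvature tensor on E with associated Jacobi operators J_X, satisfying the Rakić duality principle: for all unit vectors X, Y in E and every real λ, J_X Y = λY implies J_Y X = λX. Let X be a unit vector, let e₀ be a unit eigenvector of J_X with eigenvalue λ₀, and let Y be a unit vector orthogonal to X. Then R(Y, e₀, X, e₀) = 0. -/
open RealInnerProductSpace

/-- If the algebraic curvature tensor `R` satisfies the Rakić duality
principle, `X` is a unit vector, `e₀` is a unit eigenvector of `J X` with eigenvalue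
`lam₀`, and `Y` is a unit vector orthogonal to `X`, then `R Y e₀ X e₀ = 0`. -/
theorem curvature_mixed_term_eq_zero
    {E : Type*} [NormedAddCommGroup E] [InnerProductSpace ℝ E] [FiniteDimensional ℝ E]
    (hdim : 2 ≤ Module.finrank ℝ E)
    (R : E → E → E → E → ℝ)
    (hlin1 : ∀ Y Z W, IsLinearMap ℝ (fun X => R X Y Z W))
    (hlin2 : ∀ X Z W, IsLinearMap ℝ (fun Y => R X Y Z W))
    (hlin3 : ∀ X Y W, IsLinearMap ℝ (fun Z => R X Y Z W))
    (hlin4 : ∀ X Y Z, IsLinearMap ℝ (fun W => R X Y Z W))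
    (hanti : ∀ X Y Z W, R X Y Z W = - R Y X Z W)
    (hpair : ∀ X Y Z W, R X Y Z W = R Z W X Y)
    (hbianchi : ∀ X Y Z W, R X Y Z W + R Y Z X W + R Z X Y W = 0)
    (J : E → E →ₗ[ℝ] E)
    (hJ : ∀ X Y Z : E, ⟪J X Y, Z⟫ = R Y X X Z)
    (hduality : ∀ X Y : E, ‖X‖ = 1 → ‖Y‖ = 1 → ∀ μ : ℝ, J X Y = μ • Y → J Y X = μ • X)
    (X e₀ Y : E) (hX : ‖X‖ = 1) (he₀ : ‖e₀‖ = 1) (hY : ‖Y‖ = 1)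
    (lam₀ : ℝ) (heig : J X e₀ = lam₀ • e₀) (hXY : ⟪X, Y⟫ = 0) :
    R Y e₀ X e₀ = 0 := by
  have h1 := hduality X e₀ hX he₀ lam₀ heig
  have h2 := hJ e₀ X Y
  rw [h1, real_inner_smul_left, hXY, mul_zero, hpair, hanti] at h2
  linarith
end
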